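/- arXiv:1909.12670 — 2 statements merged into one kernel-verified Lean document; each statement's English description precedes it below -/
import Mathlib

section
/- Let r ≥ 3 and let H := K_{t₁,…,t_r} be the complete r-partite graph with class sizes t₁,…,t_r, where t_i ≥ 2 for all 1 ≤ i ≤ r. Let h := |H|, let σ be a real number with σ(H) ≤ σ < h/r, and set ω := (h − σ)/(r − 1). Let n ∈ ℕ be sufficiently large so that √n is an integer divisible by 6h², and set C := √n/(3h²). Then there exists a graph G on n vertices whose degree sequence d₁ ≤ … ≤ d_n satisfies d_i ≥ (1 − (ω + σ)/h)·n + (σ/ω)·i + C for all 1 ≤ i ≤ ωn/h, but such that G does not contain a perfect H-tiling. -/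
open SimpleGraph

/-- The degree of a vertex, as the cardinality of its neighbour set. -/
noncomputable def degN {V : Type*} (G : SimpleGraph V) (v : V) : ℕ :=
  (G.neighborSet v).ncard

/-- `f` is a copy of `H` in `G`: an injective map preserving adjacency. -/
def IsCopy {α β : Type*} (H : SimpleGraph α) (G : SimpleGraph β) (f : α → β) : Prop :=
  Function.Injective f ∧ ∀ ⦃u v : α⦄, H.Adj u v → G.Adj (f u) (f v)

/-- An `H`-tiling in `G`: a collection of vertex-disjoint copies of `H` in `G`. -/
def IsTiling {α β : Type*} (H : SimpleGraph α) (G : SimpleGraph β) (T : Set (α → β)) : Prop :=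
  (∀ f ∈ T, IsCopy H G f) ∧
    T.Pairwise fun f g => Disjoint (Set.range f) (Set.range g)

/-- `G` contains a perfect `H`-tiling. -/
def HasPerfectTiling {α β : Type*} (H : SimpleGraph α) (G : SimpleGraph β) : Prop :=
  ∃ T : Set (α → β), IsTiling H G T ∧ ∀ v : β, ∃ f ∈ T, v ∈ Set.range f

/-- `σ(H)` relative to `r` colours: the smallest possible size of a colour class in
any proper colouring of `H` with `r` colours. -/
noncomputable def minClassSize {α : Type*} (H : SimpleGraph α) (r : ℕ) : ℕ :=
  sInf {s : ℕ | ∃ (c : H.Coloring (Fin r)) (i : Fin r), s = {v | c v = i}.ncard}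

/-- `hcf_χ(H) = 1`: the highest common factor of all differences of colour class sizes
over optimal colourings is 1 (equivalently, no `d ≥ 2` divides all such differences). -/
def HcfChiOne {α : Type*} (H : SimpleGraph α) (r : ℕ) : Prop :=
  ∀ d : ℕ, 2 ≤ d →
    ¬ ∀ (c : H.Coloring (Fin r)) (i j : Fin r),
        (d : ℤ) ∣ (({v | c v = i}.ncard : ℤ) - ({v | c v = j}.ncard : ℤ))

/-- `hcf_χ(H) ≤ 2`: some difference of colour class sizes is nonzero (so `hcf_χ(H) ≠ ∞`)
and no `d ≥ 3` divides all such differences. -/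
def HcfChiLeTwo {α : Type*} (H : SimpleGraph α) (r : ℕ) : Prop :=
  (∃ (c : H.Coloring (Fin r)) (i j : Fin r),
      {v | c v = i}.ncard ≠ {v | c v = j}.ncard) ∧
    ∀ d : ℕ, 3 ≤ d →
      ¬ ∀ (c : H.Coloring (Fin r)) (i j : Fin r),
          (d : ℤ) ∣ (({v | c v = i}.ncard : ℤ) - ({v | c v = j}.ncard : ℤ))

/-- `hcf_c(H) = 1`: the highest common factor of the orders of the components of `H` is 1. -/
def HcfCompOne {α : Type*} (H : SimpleGraph α) : Prop :=
  ∀ d : ℕ, 2 ≤ d → ∃ C : H.ConnectedComponent, ¬ d ∣ C.supp.ncard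

/-- `hcf(H) = 1` for a graph `H` with `χ(H) = r`. -/
def HcfOne {α : Type*} (H : SimpleGraph α) (r : ℕ) : Prop :=
  (r = 2 → HcfCompOne H ∧ HcfChiLeTwo H 2) ∧ (r ≠ 2 → HcfChiOne H r)


/-- The graph on `Fin n` whose vertices below `N` span a `C₄`-free graph, whose vertices in
`[N, K)` split into independent intervals of length `L`, in which the vertex `K` is joined exactly
to the vertices below `K`, and which has all other edges. -/
def barrierGraph (n N L K p : ℕ) : SimpleGraph (Fin n) where
  Adj u v := u ≠ v ∧
    ((u : ℕ) < N → (v : ℕ) < N →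
      ((u : ℕ) : ZMod p) + ((v : ℕ) : ZMod p)
        = (((u : ℕ) / p : ℕ) : ZMod p) * (((v : ℕ) / p : ℕ) : ZMod p)) ∧
    (N ≤ (u : ℕ) → (u : ℕ) < K → N ≤ (v : ℕ) → (v : ℕ) < K →
      ((u : ℕ) - N) / L ≠ ((v : ℕ) - N) / L) ∧
    ((u : ℕ) = K → (v : ℕ) < K) ∧ ((v : ℕ) = K → (u : ℕ) < K)
  symm := ⟨by
    rintro u v ⟨h₁, h₂, h₃, h₄, h₅⟩
    exact ⟨h₁.symm, fun a b => by rw [add_comm, mul_comm]; exact h₂ b a,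
      fun a b c d => (h₃ c d a b).symm, h₅, h₄⟩⟩
  loopless := ⟨fun _ h => h.1 rfl⟩

lemma card_le_degN {n : ℕ} (G : SimpleGraph (Fin n)) (v : Fin n) (S : Finset ℕ)
    (hS : ∀ w ∈ S, ∃ hw : w < n, G.Adj v ⟨w, hw⟩) : S.card ≤ degN G v := by
  rw [← Finset.card_attachFin S fun w hw => (hS w hw).1, ← Set.ncard_coe_finset]
  refine Set.ncard_le_ncard (fun w hw => ?_) (Set.toFinite _)
  exact (hS w (by simpa using hw)).2

section Degrees

variable {n N L K p : ℕ}

lemma le_degN_barrierGraph_apex (hNK : N ≤ K) (hK : K < n) (v : Fin n) (hv : (v : ℕ) = K) :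
    K ≤ degN (barrierGraph n N L K p) v := by
  have := card_le_degN (barrierGraph n N L K p) v (Finset.range K) fun w hw => by
    rw [Finset.mem_range] at hw
    exact ⟨hw.trans hK, by simp only [barrierGraph, ne_eq, Fin.ext_iff]; omega⟩
  simpa using this

lemma le_degN_barrierGraph_top (hNK : N ≤ K) (v : Fin n) (hv : K < (v : ℕ)) :
    n - 2 ≤ degN (barrierGraph n N L K p) v := by
  refine le_trans ?_ (card_le_degN (barrierGraph n N L K p) v
    (Finset.range n \ {K, (v : ℕ)}) fun w hw => ?_)
  · have h₁ := Finset.le_card_sdiff {K, (v : ℕ)} (Finset.range n)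
    have h₂ : ({K, (v : ℕ)} : Finset ℕ).card ≤ 2 := Finset.card_le_two
    rw [Finset.card_range] at h₁
    omega
  · simp only [Finset.mem_sdiff, Finset.mem_range, Finset.mem_insert,
      Finset.mem_singleton] at hw
    exact ⟨hw.1, by simp only [barrierGraph, ne_eq, Fin.ext_iff]; omega⟩

lemma le_degN_barrierGraph_middle (hL : 0 < L) (v : Fin n)
    (hNv : N ≤ (v : ℕ)) (hv : (v : ℕ) < K) :
    n - L ≤ degN (barrierGraph n N L K p) v := by
  set j := ((v : ℕ) - N) / L with hj
  refine le_trans ?_ (card_le_degN (barrierGraph n N L K p) v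
    (Finset.range n \ Finset.Ico (N + j * L) (N + j * L + L)) fun w hw => ?_)
  · have h₁ := Finset.le_card_sdiff (Finset.Ico (N + j * L) (N + j * L + L)) (Finset.range n)
    rw [Finset.card_range, Nat.card_Ico] at h₁
    omega
  · simp only [Finset.mem_sdiff, Finset.mem_range, Finset.mem_Ico] at hw
    have key : N ≤ w → j ≠ (w - N) / L := by
      intro hw' h
      have h₁ := Nat.div_mul_le_self (w - N) L
      have h₂ := Nat.lt_div_mul_add (a := w - N) hL
      rw [← h] at h₁ h₂
      omega
    have hne : (v : ℕ) ≠ w := by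
      intro h
      exact key (h ▸ hNv) (by rw [hj, h])
    refine ⟨hw.1, ?_⟩
    simp only [barrierGraph, ne_eq, Fin.ext_iff]
    exact ⟨hne, by omega, fun _ _ hw' _ => key hw', by omega, by omega⟩

lemma le_degN_barrierGraph_bottom (hp : p.Prime) (hNK : N ≤ K) (hK : K < n)
    (v : Fin n) (hv : (v : ℕ) < N) :
    n - N + (N / p - 1) ≤ degN (barrierGraph n N L K p) v := by
  have : Fact p.Prime := ⟨hp⟩
  have hp0 := hp.pos
  let g : ℕ → ℕ := fun c =>
    p * c + (((((v : ℕ) / p : ℕ) : ZMod p) * (c : ZMod p) - ((v : ℕ) : ZMod p))).val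
  have hg : ∀ c, g c / p = c := fun c => by
    rw [Nat.mul_add_div hp0, Nat.div_eq_of_lt (ZMod.val_lt _), add_zero]
  have hgN : ∀ c < N / p, g c < N := fun c hc => by
    have h₁ : p * (c + 1) ≤ N := (Nat.mul_le_mul_left p hc).trans (Nat.mul_div_le N p)
    have h₂ := ZMod.val_lt ((((v : ℕ) / p : ℕ) : ZMod p) * (c : ZMod p) - ((v : ℕ) : ZMod p))
    simp only [g]
    rw [mul_add, mul_one] at h₁
    omega
  let S := (Finset.range (N / p)).erase ((v : ℕ) / p)
  have hdisj : Disjoint (Finset.Ico N n) (S.image g) := by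
    rw [Finset.disjoint_left]
    intro w hw hw'
    obtain ⟨c, hc, rfl⟩ := Finset.mem_image.1 hw'
    have := hgN c (Finset.mem_range.1 (Finset.mem_of_mem_erase hc))
    have := (Finset.mem_Ico.1 hw).1
    omega
  refine le_trans ?_ (card_le_degN (barrierGraph n N L K p) v
    (Finset.Ico N n ∪ S.image g) fun w hw => ?_)
  · rw [Finset.card_union_of_disjoint hdisj, Nat.card_Ico,
      Finset.card_image_of_injective S (Function.LeftInverse.injective (g := (· / p)) hg)]
    have := Finset.pred_card_le_card_erase (s := Finset.range (N / p)) (a := (v : ℕ) / p)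
    rw [Finset.card_range] at this
    exact Nat.add_le_add_left this _
  · rcases Finset.mem_union.1 hw with hw | hw
    · rw [Finset.mem_Ico] at hw
      exact ⟨hw.2, by simp only [barrierGraph, ne_eq, Fin.ext_iff]; omega⟩
    · obtain ⟨c, hc, rfl⟩ := Finset.mem_image.1 hw
      obtain ⟨hcv, hc⟩ := Finset.mem_erase.1 hc
      have hlt := hgN c (Finset.mem_range.1 hc)
      refine ⟨by omega, ?_⟩
      simp only [barrierGraph, ne_eq, Fin.ext_iff]
      refine ⟨fun h => hcv ?_, fun _ _ => ?_, by omega, by omega, by omega⟩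
      · rw [h, hg]
      · rw [hg]
        simp [g]

end Degrees

/-- The vertices below `N` of `barrierGraph` span no `C₄`. -/
lemma barrierGraph_no_four_cycle {n N L K p : ℕ} (hp : p.Prime) (hN : N ≤ p ^ 2)
    {u₁ u₂ v₁ v₂ : Fin n} (hu : u₁ ≠ u₂) (hv : v₁ ≠ v₂)
    (hu₁ : (u₁ : ℕ) < N) (hu₂ : (u₂ : ℕ) < N) (hv₁ : (v₁ : ℕ) < N) (hv₂ : (v₂ : ℕ) < N)
    (h₁₁ : (barrierGraph n N L K p).Adj u₁ v₁) (h₁₂ : (barrierGraph n N L K p).Adj u₁ v₂)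
    (h₂₁ : (barrierGraph n N L K p).Adj u₂ v₁) (h₂₂ : (barrierGraph n N L K p).Adj u₂ v₂) :
    False := by
  have : Fact p.Prime := ⟨hp⟩
  have e₁₁ := h₁₁.2.1 hu₁ hv₁
  have e₁₂ := h₁₂.2.1 hu₁ hv₂
  have e₂₁ := h₂₁.2.1 hu₂ hv₁
  have e₂₂ := h₂₂.2.1 hu₂ hv₂
  have div_lt : ∀ a : ℕ, a < N → a / p < p := fun a ha =>
    Nat.div_lt_of_lt_mul (by nlinarith)
  have cast_inj : ∀ a b : ℕ, a < p → b < p → (a : ZMod p) = b → a = b := fun a b ha hb h => by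
    have := (ZMod.natCast_eq_natCast_iff' a b p).1 h
    rwa [Nat.mod_eq_of_lt ha, Nat.mod_eq_of_lt hb] at this
  have eq_of : ∀ a b : ℕ, a / p = b / p → (a : ZMod p) = b → a = b := fun a b h h' => by
    have := (ZMod.natCast_eq_natCast_iff' a b p).1 h'
    rw [← Nat.div_add_mod a p, ← Nat.div_add_mod b p, h, this]
  have hprod : ((((u₁ : ℕ) / p : ℕ) : ZMod p) - (((u₂ : ℕ) / p : ℕ) : ZMod p)) *
      ((((v₁ : ℕ) / p : ℕ) : ZMod p) - (((v₂ : ℕ) / p : ℕ) : ZMod p)) = 0 := by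
    linear_combination -e₁₁ + e₁₂ + e₂₁ - e₂₂
  rcases mul_eq_zero.1 hprod with h | h
  · have h' := cast_inj _ _ (div_lt _ hu₁) (div_lt _ hu₂) (sub_eq_zero.1 h)
    refine hu (Fin.ext (eq_of _ _ h' ?_))
    rw [h'] at e₁₁
    linear_combination e₁₁ - e₂₁
  · have h' := cast_inj _ _ (div_lt _ hv₁) (div_lt _ hv₂) (sub_eq_zero.1 h)
    refine hv (Fin.ext (eq_of _ _ h' ?_))
    rw [h'] at e₁₁
    linear_combination e₁₁ - e₁₂

/-- The vertex `K` of `barrierGraph` lies in no copy of a complete `r`-partite graph with all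
classes of size at least two. -/
lemma not_isCopy_barrierGraph {n N L K p r : ℕ} (hp : p.Prime) (hN : N ≤ p ^ 2) (hr : 3 ≤ r)
    (hL : 0 < L) (hK : K = N + (r - 3) * L) (t : Fin r → ℕ) (ht : ∀ i, 2 ≤ t i)
    (f : (Σ i, Fin (t i)) → Fin n)
    (hf : IsCopy (completeMultipartiteGraph fun i => Fin (t i)) (barrierGraph n N L K p) f)
    (x : Σ i, Fin (t i)) : (f x : ℕ) ≠ K := by
  intro hx
  obtain ⟨hinj, hadj⟩ := hf
  have adj : ∀ a b : Σ i, Fin (t i), a.1 ≠ b.1 → (barrierGraph n N L K p).Adj (f a) (f b) :=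
    fun a b hab => hadj (by simpa using hab)
  have hlt : ∀ a : Σ i, Fin (t i), a.1 ≠ x.1 → (f a : ℕ) < K := fun a ha =>
    (adj x a ha.symm).2.2.2.1 hx
  classical
  let B := (Finset.univ.erase x.1).filter fun i => ∃ a : Σ i, Fin (t i), a.1 = i ∧ N ≤ (f a : ℕ)
  have hB : B.card ≤ r - 3 := by
    have hB' : ∀ i : Fin r, i ∈ B → ∃ a : Σ i, Fin (t i), a.1 = i ∧ N ≤ (f a : ℕ) := fun i hi =>
      (Finset.mem_filter.1 hi).2
    have hBx : ∀ i : Fin r, i ∈ B → i ≠ x.1 := fun i hi =>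
      Finset.ne_of_mem_erase (Finset.mem_filter.1 hi).1
    have : Nonempty (Σ i, Fin (t i)) := ⟨x⟩
    choose! a ha haN using hB'
    have haK : ∀ i ∈ B, (f (a i) : ℕ) < K := fun i hi => hlt _ (by rw [ha i hi]; exact hBx i hi)
    rw [← Finset.card_range (r - 3)]
    refine Finset.card_le_card_of_injOn (fun i => ((f (a i) : ℕ) - N) / L) ?_ ?_
    · intro i hi
      have h₁ := haK i hi
      have h₂ := haN i hi
      simp only [Finset.coe_range, Set.mem_Iio]
      rw [Nat.div_lt_iff_lt_mul hL]
      omega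
    · intro i hi j hj hij
      by_contra hne
      exact (adj (a i) (a j) (by rwa [ha i hi, ha j hj])).2.2.1 (haN i hi) (haK i hi)
        (haN j hj) (haK j hj) hij
  have hcard : 1 < ((Finset.univ.erase x.1) \ B).card := by
    have h₁ := Finset.le_card_sdiff B (Finset.univ.erase x.1)
    rw [Finset.card_erase_of_mem (Finset.mem_univ _), Finset.card_univ, Fintype.card_fin] at h₁
    omega
  obtain ⟨i, hi, j, hj, hij⟩ := Finset.one_lt_card.1 hcard
  have low : ∀ i ∈ (Finset.univ.erase x.1) \ B, ∀ a : Fin (t i), (f ⟨i, a⟩ : ℕ) < N := by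
    intro i hi a
    obtain ⟨hi, hiB⟩ := Finset.mem_sdiff.1 hi
    by_contra! h
    exact hiB (Finset.mem_filter.2 ⟨hi, ⟨i, a⟩, rfl, h⟩)
  have ne : ∀ i, f ⟨i, ⟨0, by have := ht i; omega⟩⟩ ≠ f ⟨i, ⟨1, by have := ht i; omega⟩⟩ := by
    intro i h
    simpa using hinj h
  exact barrierGraph_no_four_cycle hp hN (ne i) (ne j) (low i hi _) (low i hi _) (low j hj _)
    (low j hj _) (adj _ _ hij) (adj _ _ hij) (adj _ _ hij) (adj _ _ hij)

/-- A lower bound on an ordered degree sequence in which at most one vertex has low degree. -/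
lemma exists_sorted_degN_ge {n : ℕ} (G : SimpleGraph (Fin n)) (x : Fin n) (b : ℕ → ℝ)
    (P : ℕ → Prop) (T : ℝ) (hb : ∀ i, P i → b i ≤ T) (hx : b 0 ≤ degN G x)
    (hG : ∀ v, v ≠ x → T ≤ degN G v) :
    ∃ e : Fin n ≃ Fin n, (∀ i j : Fin n, i ≤ j → degN G (e i) ≤ degN G (e j)) ∧
      ∀ i : Fin n, P i → b i ≤ (degN G (e i) : ℝ) := by
  refine ⟨Tuple.sort (degN G), fun i j hij => Tuple.monotone_sort (degN G) hij, fun i hi => ?_⟩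
  by_cases hix : Tuple.sort (degN G) i = x
  · rcases Nat.eq_zero_or_pos (i : ℕ) with h0 | h0
    · rw [hix, h0]; exact hx
    · let z : Fin n := ⟨0, by omega⟩
      have hz : Tuple.sort (degN G) z ≠ x := fun h => by
        have := (Tuple.sort (degN G)).injective (h.trans hix.symm)
        have := congrArg Fin.val this
        simp only [z] at this
        omega
      have hle : degN G (Tuple.sort (degN G) z) ≤ degN G (Tuple.sort (degN G) i) :=
        Tuple.monotone_sort (degN G) (Fin.le_def.2 (Nat.zero_le _))
      exact (hb i hi).trans ((hG _ hz).trans (by exact_mod_cast hle))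
  · exact (hb i hi).trans (hG _ hix)

/-- Choice of the parameters of `barrierGraph`. -/
lemma exists_barrierGraph_parameters {r q m : ℕ} (hr : 3 ≤ r) (hq1 : 1 ≤ q)
    (hmq : 24 * r ^ 2 * q ≤ m) {W : ℝ} (hWup : ((r : ℝ) - 1) * W ≤ (m : ℝ) ^ 2)
    (hWlow : (m : ℝ) ^ 2 ≤ r * W) :
    2 ≤ W - 2 * q ∧ ∃ N L p : ℕ, p.Prime ∧ N ≤ p ^ 2 ∧ 0 < L ∧ N + (r - 3) * L < m ^ 2 ∧
      12 * r * q ≤ N / p ∧ (L : ℝ) ≤ W - 2 * q ∧ (N : ℝ) ≤ W + 1 + 2 * (r * q) + r ∧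
      ((r : ℝ) - 2) * W + 2 * q + 1 ≤ ((N + (r - 3) * L : ℕ) : ℝ) := by
  have hm : 0 < m := lt_of_lt_of_le (by positivity) hmq
  have hr' : (3 : ℝ) ≤ r := by exact_mod_cast hr
  have hq' : (1 : ℝ) ≤ q := by exact_mod_cast hq1
  have hm' : (1 : ℝ) ≤ m := by exact_mod_cast hm
  have hmq' : 24 * (r : ℝ) ^ 2 * q ≤ m := by exact_mod_cast hmq
  have hWbig : 24 * (r : ℝ) * q * m ≤ W := by
    have h₁ : (r : ℝ) * (24 * r * q * m) ≤ r * W := by nlinarith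
    exact le_of_mul_le_mul_left h₁ (by linarith)
  have hrq : (r : ℝ) ≤ r * q := by nlinarith
  have hqrq : 3 * (q : ℝ) ≤ r * q := by nlinarith
  have hWbig' : 24 * ((r : ℝ) * q) ≤ W := by nlinarith
  set L := ⌊W - 2 * q⌋₊ with hLdef
  set N := ⌈W⌉₊ + 2 * r * q + r with hNdef
  set K := N + (r - 3) * L with hKdef
  have hLle : (L : ℝ) ≤ W - 2 * q := Nat.floor_le (by linarith)
  have hLlt : W - 2 * q - 1 < L := Nat.sub_one_lt_floor _
  have hL0 : 0 < L := by
    have : (0 : ℝ) < L := by linarith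
    exact_mod_cast this
  have hNge : W + 2 * (r * q) + r ≤ N := by
    have := Nat.le_ceil W
    rw [hNdef]; push_cast; linarith
  have hNle : (N : ℝ) ≤ W + 1 + 2 * (r * q) + r := by
    have := (Nat.ceil_lt_add_one (by linarith : 0 ≤ W)).le
    rw [hNdef]; push_cast; linarith
  have hKcast : (K : ℝ) = N + ((r : ℝ) - 3) * L := by
    rw [hKdef]; push_cast [Nat.cast_sub hr]; ring
  have hKn : K < m ^ 2 := by
    have : (K : ℝ) < (m : ℝ) ^ 2 := by
      have := mul_le_mul_of_nonneg_left hLle (by linarith : (0 : ℝ) ≤ (r : ℝ) - 3)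
      linarith
    exact_mod_cast this
  have hNK : N ≤ K := Nat.le_add_right _ _
  obtain ⟨p, hp, hmp, hpm⟩ := Nat.exists_prime_lt_and_le_two_mul m hm.ne'
  have hNp : N ≤ p ^ 2 := (hNK.trans hKn.le).trans (Nat.pow_le_pow_left hmp.le 2)
  have hdiv : 12 * r * q ≤ N / p := by
    rw [Nat.le_div_iff_mul_le hp.pos]
    have h₁ : 12 * r * q * p ≤ 24 * r * q * m :=
      (Nat.mul_le_mul_left _ hpm).trans_eq (by ring)
    have h₂ : 24 * r * q * m ≤ N := by
      have : 24 * (r : ℝ) * q * m ≤ N := by linarith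
      exact_mod_cast this
    exact h₁.trans h₂
  refine ⟨by linarith, N, L, p, hp, hNp, hL0, hKn, hdiv, hLle, hNle, ?_⟩
  rw [← hKdef, hKcast]
  have := mul_le_mul_of_nonneg_left hLlt.le (by linarith : (0 : ℝ) ≤ (r : ℝ) - 3)
  linarith

/-- Proposition 2.2: for complete `r`-partite graphs `H` with all class
sizes at least 2, the `ηn`-term in the degree sequence condition cannot be replaced by a
`o(√n)`-term. Here `n = m²` and `C = √n/(3h²) = m/(3h²)`. -/
theorem extremal_example_sqrt
    (r : ℕ) (hr : 3 ≤ r) (t : Fin r → ℕ) (ht : ∀ i, 2 ≤ t i)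
    (σ ω h : ℝ) (hh : h = ((∑ i, t i : ℕ) : ℝ))
    (hσ₁ : (minClassSize (completeMultipartiteGraph fun i => Fin (t i)) r : ℝ) ≤ σ)
    (hσ₂ : σ < h / r)
    (hω : ω = (h - σ) / ((r : ℝ) - 1)) :
    ∃ n₀ : ℕ, ∀ n m : ℕ, n₀ ≤ n → n = m ^ 2 → 6 * (∑ i, t i) ^ 2 ∣ m →
      ∃ G : SimpleGraph (Fin n),
        (∃ e : Fin n ≃ Fin n,
          (∀ i j : Fin n, i ≤ j → degN G (e i) ≤ degN G (e j)) ∧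
          (∀ i : Fin n, ((i : ℕ) + 1 : ℝ) ≤ ω * n / h →
            (1 - (ω + σ) / h) * n + (σ / ω) * ((i : ℕ) + 1) + (m : ℝ) / (3 * h ^ 2)
              ≤ (degN G (e i) : ℝ))) ∧
        ¬ HasPerfectTiling (completeMultipartiteGraph fun i => Fin (t i)) G := by
  refine ⟨1, ?_⟩
  rintro n m hn rfl ⟨q, hq⟩
  set s := ∑ i, t i with hs
  have hσ0 : 0 ≤ σ := (Nat.cast_nonneg _).trans hσ₁
  have hm : 0 < m := Nat.pos_of_ne_zero fun h => by simp [h] at hn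
  have hq1 : 1 ≤ q := Nat.pos_of_ne_zero fun h => by simp [h] at hq; omega
  have hsr : 2 * r ≤ s := by
    have := Finset.card_nsmul_le_sum Finset.univ t 2 fun i _ => ht i
    simpa [mul_comm] using this
  have hmq : 24 * r ^ 2 * q ≤ m := by
    rw [hq]
    refine Nat.mul_le_mul_right q ?_
    nlinarith
  have hr' : (3 : ℝ) ≤ r := by exact_mod_cast hr
  have hq' : (1 : ℝ) ≤ q := by exact_mod_cast hq1
  have hh0 : 0 < h := by
    have : (0 : ℝ) < s := by exact_mod_cast (by omega : 0 < s)
    rwa [hh]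
  have hC : (m : ℝ) / (3 * h ^ 2) = 2 * q := by
    rw [hh, hq]
    rw [hh] at hh0
    push_cast
    field_simp
    norm_num
  have hsum : ((r : ℝ) - 1) * ω + σ = h := by
    rw [hω, mul_div_cancel₀ _ (by linarith)]
    ring
  have hσr : σ * r < h := by rwa [lt_div_iff₀ (by linarith)] at hσ₂
  have hωr : h ≤ r * ω := by nlinarith
  have hω0 : 0 < ω := by
    by_contra! hneg
    nlinarith
  have hσω : σ ≤ ω := by nlinarith
  obtain ⟨W, hW⟩ : ∃ W : ℝ, W = ω * ((m ^ 2 : ℕ) : ℝ) / h := ⟨_, rfl⟩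
  have hWup : ((r : ℝ) - 1) * W ≤ (m : ℝ) ^ 2 := by
    rw [hW, mul_div_assoc', div_le_iff₀ hh0]
    push_cast
    nlinarith
  have hWlow : (m : ℝ) ^ 2 ≤ r * W := by
    rw [hW, mul_div_assoc', le_div_iff₀ hh0]
    push_cast
    nlinarith
  obtain ⟨hW2, N, L, p, hp, hNp, hL0, hKn, hdiv, hLle, hNle, hKge⟩ :=
    exists_barrierGraph_parameters hr hq1 hmq hWup hWlow
  have hNK : N ≤ N + (r - 3) * L := Nat.le_add_right _ _
  have hT : (1 - (ω + σ) / h) * ((m ^ 2 : ℕ) : ℝ) = ((r : ℝ) - 2) * W := by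
    have : ω + σ = h - ((r : ℝ) - 2) * ω := by linarith
    rw [hW, this]
    field_simp
    ring
  have hσn : σ / h * ((m ^ 2 : ℕ) : ℝ) = (m : ℝ) ^ 2 - ((r : ℝ) - 1) * W := by
    rw [hW]
    have : σ = h - ((r : ℝ) - 1) * ω := by linarith
    rw [this]
    push_cast
    field_simp
  refine ⟨barrierGraph (m ^ 2) N L (N + (r - 3) * L) p, ?_, ?_⟩
  · rw [hT, hC, ← hW]
    refine exists_sorted_degN_ge _ ⟨N + (r - 3) * L, hKn⟩
      (fun i => ((r : ℝ) - 2) * W + σ / ω * ((i : ℝ) + 1) + 2 * q) (fun i => (i : ℝ) + 1 ≤ W)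
      ((m : ℝ) ^ 2 - W + 2 * q) ?_ ?_ ?_
    · intro i hi
      have h₁ : σ / ω * ((i : ℝ) + 1) ≤ σ / ω * W :=
        mul_le_mul_of_nonneg_left hi (by positivity)
      have h₂ : σ / ω * W = σ / h * ((m ^ 2 : ℕ) : ℝ) := by
        rw [hW]; field_simp
      linarith
    · have h₁ : ((N + (r - 3) * L : ℕ) : ℝ)
          ≤ degN (barrierGraph (m ^ 2) N L (N + (r - 3) * L) p) ⟨N + (r - 3) * L, hKn⟩ := by
        exact_mod_cast le_degN_barrierGraph_apex hNK hKn _ rfl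
      have h₂ : σ / ω ≤ 1 := (div_le_one hω0).2 hσω
      simp only [Nat.cast_zero, zero_add, mul_one]
      linarith
    · intro v hv
      have hv' : (v : ℕ) ≠ N + (r - 3) * L := fun h => hv (Fin.ext h)
      have hvn := v.2
      rcases lt_or_ge (v : ℕ) N with hvN | hvN
      · have h₁ := le_degN_barrierGraph_bottom (L := L) hp hNK hKn v hvN
        have h₂ : m ^ 2 + 12 * r * q
            ≤ degN (barrierGraph (m ^ 2) N L (N + (r - 3) * L) p) v + N + 1 := by omega
        have h₃ : (m : ℝ) ^ 2 + 12 * r * q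
            ≤ degN (barrierGraph (m ^ 2) N L (N + (r - 3) * L) p) v + N + 1 := by exact_mod_cast h₂
        have h₄ : (r : ℝ) ≤ r * q := le_mul_of_one_le_right (by linarith) hq'
        have h₅ : 3 * (q : ℝ) ≤ r * q := mul_le_mul_of_nonneg_right hr' (by linarith)
        linarith
      · rcases lt_or_gt_of_ne hv' with hvK | hvK
        · have h₁ := le_degN_barrierGraph_middle (p := p) hL0 v hvN hvK
          have h₂ : m ^ 2
              ≤ degN (barrierGraph (m ^ 2) N L (N + (r - 3) * L) p) v + L := by omega
          have h₃ : (m : ℝ) ^ 2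
              ≤ degN (barrierGraph (m ^ 2) N L (N + (r - 3) * L) p) v + L := by
            exact_mod_cast h₂
          linarith
        · have h₁ := le_degN_barrierGraph_top (L := L) (p := p) hNK v hvK
          have h₂ : m ^ 2
              ≤ degN (barrierGraph (m ^ 2) N L (N + (r - 3) * L) p) v + 2 := by omega
          have h₃ : (m : ℝ) ^ 2
              ≤ degN (barrierGraph (m ^ 2) N L (N + (r - 3) * L) p) v + 2 := by
            exact_mod_cast h₂
          linarith
  · rintro ⟨𝒯, ⟨hcopy, -⟩, hcover⟩
    obtain ⟨f, hf, x, hx⟩ := hcover ⟨N + (r - 3) * L, hKn⟩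
    exact not_isCopy_barrierGraph hp hNp hr hL0 rfl t ht f (hcopy f hf) x
      (congrArg Fin.val hx)
end

section
/- Let H be a graph with χ(H) =: r ≥ 2 and hcf(H) = 1. Let h := |H|, let σ be a real number with σ(H) ≤ σ < h/r, and set ω := (h − σ)/(r − 1). Then there exist constants λ₂ > 0 and β₂ > 0 with 0 < β₂ ≪ λ₂ ≪ σ/ω, 1 − σ/ω, 1/h, and an integer N, such that the following holds. Suppose F is a complete r-partite graph with vertex classes U₁, …, U_r such that: |F| ≥ N; |F| is divisible by h; (1 − λ₂^{1/10})|U_r| ≤ σ|U_i|/ω ≤ (1 − λ₂)|U_r| for all i < r; and ||U_i| − |U_j|| ≤ β₂|F| whenever 1 ≤ i < j < r. Then F contains a perfect H-tiling. -/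
open SimpleGraph

namespace SimpleGraph

variable {α : Type*} {H : SimpleGraph α} {r : ℕ}

/-- The vector of colour class sizes of a colouring. -/
noncomputable def classSizes (c : H.Coloring (Fin r)) (i : Fin r) : ℤ :=
  ({v | c v = i}.ncard : ℤ)

instance finite_coloring [Finite α] : Finite (H.Coloring (Fin r)) :=
  DFunLike.finite _

theorem classSizes_eq_sum [Fintype α] (c : H.Coloring (Fin r)) :
    classSizes c = ∑ v, Pi.single (c v) (1 : ℤ) := by
  classical
  funext i
  rw [Finset.sum_apply, classSizes, Set.ncard_eq_toFinset_card']
  simp [Pi.single_apply, eq_comm]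

theorem sum_classSizes [Fintype α] (c : H.Coloring (Fin r)) :
    ∑ i, classSizes c i = (Fintype.card α : ℤ) := by
  simp only [classSizes_eq_sum, Finset.sum_apply]
  rw [Finset.sum_comm]
  simp

/-- Renaming the colours of a colouring. -/
def Coloring.permute (π : Equiv.Perm (Fin r)) : H.Coloring (Fin r) ≃ H.Coloring (Fin r) where
  toFun c := Coloring.mk (fun v => π (c v)) fun h => π.injective.ne (c.valid h)
  invFun c := Coloring.mk (fun v => π.symm (c v)) fun h => π.symm.injective.ne (c.valid h)
  left_inv c := by ext v; simp [Coloring.mk]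
  right_inv c := by ext v; simp [Coloring.mk]

theorem classSizes_permute (π : Equiv.Perm (Fin r)) (c : H.Coloring (Fin r)) (i : Fin r) :
    classSizes (Coloring.permute π c) (π i) = classSizes c i := by
  have h : {v | Coloring.permute π c v = π i} = {v | c v = i} := by
    ext v
    exact π.injective.eq_iff
  rw [classSizes, classSizes, h]

open Classical in
/-- Swapping two colours on a set closed under adjacency. -/
noncomputable def Coloring.swapOn (c : H.Coloring (Fin r)) (k l : Fin r) (C : Set α)
    (hC : ∀ ⦃u v⦄, H.Adj u v → (u ∈ C ↔ v ∈ C)) : H.Coloring (Fin r) :=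
  Coloring.mk (fun v => if v ∈ C then Equiv.swap k l (c v) else c v) <| by
    intro u v h
    have hc := c.valid h
    by_cases hu : u ∈ C
    · simpa [hu, (hC h).1 hu] using hc
    · have hv : v ∉ C := fun hv => hu ((hC h).2 hv)
      simpa [hu, hv] using hc

theorem single_sub_single_swap (i k l : Fin r) (hkl : k ≠ l) :
    (Pi.single i 1 - Pi.single (Equiv.swap k l i) 1 : Fin r → ℤ) =
      ((if i = k then 1 else 0) - (if i = l then 1 else 0) : ℤ) •
        (Pi.single k 1 - Pi.single l 1) := by
  by_cases hik : i = k
  · subst hik; simp [hkl]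
  · by_cases hil : i = l
    · subst hil; simp [hik]
    · simp [hik, hil, Equiv.swap_apply_of_ne_of_ne hik hil]

theorem ncard_sub_smul_mem_span [Fintype α] (c : H.Coloring (Fin r)) {k l : Fin r} (hkl : k ≠ l)
    (C : Set α) (hC : ∀ ⦃u v⦄, H.Adj u v → (u ∈ C ↔ v ∈ C)) :
    (({v | v ∈ C ∧ c v = k}.ncard : ℤ) - ({v | v ∈ C ∧ c v = l}.ncard : ℤ)) •
        (Pi.single k 1 - Pi.single l 1 : Fin r → ℤ) ∈
      Submodule.span ℤ (Set.range (classSizes (H := H) (r := r))) := by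
  classical
  have key : (({v | v ∈ C ∧ c v = k}.ncard : ℤ) - ({v | v ∈ C ∧ c v = l}.ncard : ℤ)) •
        (Pi.single k 1 - Pi.single l 1 : Fin r → ℤ) =
      classSizes c - classSizes (c.swapOn k l C hC) := by
    rw [classSizes_eq_sum, classSizes_eq_sum, ← Finset.sum_sub_distrib]
    have h (v : α) : (Pi.single (c v) 1 - Pi.single (c.swapOn k l C hC v) 1 : Fin r → ℤ) =
        ((if v ∈ C ∧ c v = k then 1 else 0) - (if v ∈ C ∧ c v = l then 1 else 0) : ℤ) •
          (Pi.single k 1 - Pi.single l 1) := by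
      have hv : c.swapOn k l C hC v = if v ∈ C then Equiv.swap k l (c v) else c v := rfl
      by_cases hvC : v ∈ C
      · rw [hv, if_pos hvC, single_sub_single_swap _ _ _ hkl]
        simp [hvC]
      · simp [hv, hvC]
    rw [Finset.sum_congr rfl fun v _ => h v, ← Finset.sum_smul, Finset.sum_sub_distrib]
    simp [Set.ncard_eq_toFinset_card']
  rw [key]
  exact sub_mem (Submodule.subset_span ⟨_, rfl⟩) (Submodule.subset_span ⟨_, rfl⟩)

theorem exists_perm_apply_eq {β : Type*} [DecidableEq β] {i j k l : β} (hij : i ≠ j)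
    (hkl : k ≠ l) : ∃ π : Equiv.Perm β, π i = k ∧ π j = l := by
  refine ⟨Equiv.swap (Equiv.swap i k j) l * Equiv.swap i k, ?_, ?_⟩
  · have h : k ≠ Equiv.swap i k j := by
      intro h
      apply hij
      exact (Equiv.swap i k).injective ((Equiv.swap_apply_left i k).trans h)
    simp [Equiv.swap_apply_of_ne_of_ne h hkl]
  · simp

theorem classSizes_sub_smul_mem_span [Fintype α] (c : H.Coloring (Fin r)) {k l : Fin r}
    (hkl : k ≠ l) (i j : Fin r) :
    (classSizes c i - classSizes c j) • (Pi.single k 1 - Pi.single l 1 : Fin r → ℤ) ∈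
      Submodule.span ℤ (Set.range (classSizes (H := H) (r := r))) := by
  by_cases hij : i = j
  · simp [hij]
  obtain ⟨π, rfl, rfl⟩ := exists_perm_apply_eq hij hkl
  have h := ncard_sub_smul_mem_span (Coloring.permute π c) hkl Set.univ (by simp)
  rw [← classSizes_permute π c i, ← classSizes_permute π c j]
  simpa [classSizes] using h

theorem single_sub_single_mem_span [Fintype α] (hhcf : HcfOne H r) (hH : H.Colorable r)
    {k l : Fin r} (hkl : k ≠ l) :
    (Pi.single k 1 - Pi.single l 1 : Fin r → ℤ) ∈
      Submodule.span ℤ (Set.range (classSizes (H := H) (r := r))) := by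
  set e : Fin r → ℤ := Pi.single k 1 - Pi.single l 1
  set L := Submodule.span ℤ (Set.range (classSizes (H := H) (r := r)))
  let J : Ideal ℤ := L.comap (LinearMap.toSpanSingleton ℤ (Fin r → ℤ) e)
  have hJ (t : ℤ) : t ∈ J ↔ t • e ∈ L := Iff.rfl
  obtain ⟨d, hd⟩ := (IsPrincipalIdealRing.principal J).principal
  have hd' (t : ℤ) : t ∈ J ↔ d ∣ t := by rw [hd]; exact Ideal.mem_span_singleton
  by_cases h1 : d.natAbs = 1
  · have h : (1 : ℤ) ∈ J := (hd' 1).2 (Int.natAbs_dvd_natAbs.1 (by simp [h1]))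
    simpa [hJ] using h
  exfalso
  obtain ⟨m, hm, hmd⟩ : ∃ m : ℕ, 2 ≤ m ∧ (m : ℤ) ∣ d := by
    by_cases h0 : d = 0
    · exact ⟨2, le_rfl, by simp [h0]⟩
    · exact ⟨d.natAbs, by omega, Int.natAbs_dvd.2 dvd_rfl⟩
  have hdiff (c : H.Coloring (Fin r)) (i j : Fin r) :
      (m : ℤ) ∣ (({v | c v = i}.ncard : ℤ) - ({v | c v = j}.ncard : ℤ)) :=
    hmd.trans ((hd' _).1 ((hJ _).2 (classSizes_sub_smul_mem_span c hkl i j)))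
  by_cases hr : r = 2
  · subst hr
    obtain ⟨hcomp, -, hthree⟩ := hhcf.1 rfl
    obtain rfl : m = 2 := by
      by_contra hm2
      exact hthree m (by omega) hdiff
    obtain ⟨C, hC⟩ := hcomp 2 le_rfl
    apply hC
    obtain ⟨c⟩ := hH
    have hmem := hmd.trans ((hd' _).1 ((hJ _).2 (ncard_sub_smul_mem_span c hkl C.supp fun u v h =>
      C.mem_supp_congr_adj h)))
    have hunion : C.supp = {v | v ∈ C.supp ∧ c v = k} ∪ {v | v ∈ C.supp ∧ c v = l} := by
      ext v
      have : c v = k ∨ c v = l := by omega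
      simp only [Set.mem_union, Set.mem_ofPred_eq]
      tauto
    have hcard : C.supp.ncard =
        {v | v ∈ C.supp ∧ c v = k}.ncard + {v | v ∈ C.supp ∧ c v = l}.ncard := by
      conv_lhs => rw [hunion]
      refine Set.ncard_union_eq ?_ (Set.toFinite _) (Set.toFinite _)
      rw [Set.disjoint_left]
      rintro v ⟨-, hk⟩ ⟨-, hl⟩
      exact hkl (hk.symm.trans hl)
    push_cast at hmem
    omega
  · exact hhcf.2 hr m hm hdiff

theorem exists_bounded_combination [Fintype α] [Fintype (H.Coloring (Fin r))] (hr : 0 < r)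
    (hhcf : HcfOne H r) (hH : H.Colorable r) :
    ∃ K : ℤ, 0 ≤ K ∧ ∀ w : Fin r → ℤ, (Fintype.card α : ℤ) ∣ ∑ i, w i →
      ∃ n : H.Coloring (Fin r) → ℤ, ∑ c, n c • classSizes c = w ∧
        ∀ c, |n c| ≤ K * ∑ i, |w i| := by
  classical
  let o : Fin r := ⟨0, hr⟩
  obtain ⟨c₀⟩ := id hH
  have hrep (i : Fin r) : ∃ n : H.Coloring (Fin r) → ℤ,
      ∑ c, n c • classSizes c = (Pi.single i 1 - Pi.single o 1 : Fin r → ℤ) := by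
    rw [← Submodule.mem_span_range_iff_exists_fun]
    by_cases hi : i = o
    · simp [hi]
    · exact single_sub_single_mem_span hhcf hH hi
  choose n hn using hrep
  set h : ℤ := (Fintype.card α : ℤ)
  let M : ℤ := ∑ i, ∑ c, |n i c|
  have hM (i c) : |n i c| ≤ M :=
    (Finset.single_le_sum (f := fun c => |n i c|) (fun _ _ => abs_nonneg _)
      (Finset.mem_univ c)).trans
    (Finset.single_le_sum (f := fun i => ∑ c, |n i c|)
      (fun _ _ => Finset.sum_nonneg fun _ _ => abs_nonneg _) (Finset.mem_univ i))
  have hM0 : 0 ≤ M := Finset.sum_nonneg fun _ _ => Finset.sum_nonneg fun _ _ => abs_nonneg _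
  have hh0 : 0 ≤ h := Int.natCast_nonneg _
  refine ⟨1 + (1 + h) * M, by positivity, fun w hw => ?_⟩
  obtain ⟨t, ht⟩ := hw
  set S := ∑ i, |w i|
  have hS0 : 0 ≤ S := Finset.sum_nonneg fun _ _ => abs_nonneg _
  have hht : h * |t| ≤ S := by
    have := Finset.abs_sum_le_sum_abs w Finset.univ
    rwa [ht, abs_mul, abs_of_nonneg hh0] at this
  obtain ⟨t, htS, ht⟩ : ∃ t, |t| ≤ S ∧ ∑ i, w i = h * t := by
    by_cases h0 : h = 0
    · exact ⟨0, by simpa using hS0, by simp [ht, h0]⟩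
    · exact ⟨t, by nlinarith [abs_nonneg t, show 1 ≤ h by omega], ht⟩
  let D : Fin r → ℤ := fun i => w i - t * classSizes c₀ i
  have hDsum : ∑ i, D i = 0 := by
    simp only [D, Finset.sum_sub_distrib, ← Finset.mul_sum, sum_classSizes, ht]
    ring
  have hcs (i) : 0 ≤ classSizes c₀ i := Int.natCast_nonneg _
  have hDabs : ∑ i, |D i| ≤ (1 + h) * S := by
    calc ∑ i, |D i| ≤ ∑ i, (|w i| + |t| * classSizes c₀ i) := by
          refine Finset.sum_le_sum fun i _ => (abs_sub _ _).trans ?_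
          rw [abs_mul, abs_of_nonneg (hcs i)]
      _ = S + |t| * h := by
          rw [Finset.sum_add_distrib, ← Finset.mul_sum, sum_classSizes]
      _ ≤ (1 + h) * S := by nlinarith
  refine ⟨fun c => (if c = c₀ then t else 0) + ∑ i, D i * n i c, ?_, fun c => ?_⟩
  · have h1 : ∑ c, (∑ i, D i * n i c) • classSizes c =
        ∑ i, D i • (Pi.single i 1 - Pi.single o 1 : Fin r → ℤ) := by
      simp_rw [← hn, Finset.smul_sum, Finset.sum_smul, mul_smul]
      rw [Finset.sum_comm]
    simp only [add_smul, Finset.sum_add_distrib, h1, ite_smul, zero_smul, smul_sub,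
      Finset.sum_sub_distrib, ← Finset.sum_smul, hDsum]
    funext j
    simp [D, Finset.sum_apply, Pi.single_apply]
  · have h1 : |∑ i, D i * n i c| ≤ (1 + h) * S * M := by
      calc |∑ i, D i * n i c| ≤ ∑ i, |D i * n i c| := Finset.abs_sum_le_sum_abs _ _
        _ ≤ ∑ i, |D i| * M := by
            refine Finset.sum_le_sum fun i _ => ?_
            rw [abs_mul]
            exact mul_le_mul_of_nonneg_left (hM i c) (abs_nonneg _)
        _ ≤ (1 + h) * S * M := by
            rw [← Finset.sum_mul]
            exact mul_le_mul_of_nonneg_right hDabs hM0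
    have h2 : |if c = c₀ then t else 0| ≤ S := by
      split_ifs
      · exact htS
      · simpa using hS0
    calc _ ≤ S + (1 + h) * S * M := (abs_add_le _ _).trans (add_le_add h2 h1)
      _ = _ := by ring

theorem hasPerfectTiling_of_sum_classSizes [Fintype α] [Fintype (H.Coloring (Fin r))]
    (u : Fin r → ℕ) (n : H.Coloring (Fin r) → ℕ)
    (hu : ∀ i, (u i : ℤ) = ∑ c, (n c : ℤ) * classSizes c i) :
    HasPerfectTiling H (completeMultipartiteGraph fun i => Fin (u i)) := by
  classical
  let color : (Σ c, Fin (n c)) × α → Fin r := fun p => p.1.1 p.2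
  have hcard (i : Fin r) : Fintype.card {p // color p = i} = u i := by
    have e : {p // color p = i} ≃ Σ τ : (Σ c, Fin (n c)), {v // τ.1 v = i} :=
      { toFun := fun p => ⟨p.1.1, p.1.2, p.2⟩
        invFun := fun p => ⟨(p.1, p.2.1), p.2.2⟩
        left_inv := fun _ => rfl
        right_inv := fun _ => rfl }
    rw [Fintype.card_congr e, Fintype.card_sigma, Fintype.sum_sigma]
    zify
    rw [hu i]
    refine Finset.sum_congr rfl fun c _ => ?_
    have h (x : Fin (n c)) :
        (Fintype.card {v // (⟨c, x⟩ : Σ c, Fin (n c)).1 v = i} : ℤ) = classSizes c i := by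
      rw [← Nat.card_eq_fintype_card]
      rfl
    refine (Finset.sum_congr rfl fun x _ => h x).trans ?_
    simp
  let e : (Σ c, Fin (n c)) × α ≃ Σ i, Fin (u i) :=
    (Equiv.sigmaFiberEquiv color).symm.trans
      (Equiv.sigmaCongrRight fun i => Fintype.equivFinOfCardEq (hcard i))
  have he (τ) (v) : (e (τ, v)).1 = τ.1 v := rfl
  refine ⟨Set.range fun τ v => e (τ, v), ⟨?_, ?_⟩, fun x => ?_⟩
  · rintro _ ⟨τ, rfl⟩
    refine ⟨fun v w h => congrArg Prod.snd (e.injective h), fun v w h => ?_⟩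
    change (e (τ, v)).1 ≠ (e (τ, w)).1
    exact τ.1.valid h
  · rintro _ ⟨τ, rfl⟩ _ ⟨τ', rfl⟩ hne
    rw [Set.disjoint_left]
    rintro _ ⟨v, rfl⟩ ⟨w, hw⟩
    exact hne (congrArg (fun τ v => e (τ, v)) (congrArg Prod.fst (e.injective hw)).symm)
  · obtain ⟨⟨τ, v⟩, rfl⟩ := e.surjective x
    exact ⟨_, ⟨τ, rfl⟩, v, rfl⟩

theorem classSizes_pos [Finite α] (hchi : H.chromaticNumber = (r : ℕ∞)) (c : H.Coloring (Fin r))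
    (i : Fin r) : 0 < classSizes c i := by
  rw [classSizes, Nat.cast_pos, Set.ncard_pos]
  by_contra hne
  have hne (v : α) : c v ≠ i := fun hv => hne ⟨v, hv⟩
  let c' : H.Coloring {j // j ≠ i} :=
    Coloring.mk (fun v => ⟨c v, hne v⟩) fun h h' => c.valid h (congrArg Subtype.val h')
  have hle := c'.colorable.chromaticNumber_le
  rw [hchi, Nat.cast_le, Fintype.card_subtype_compl, Fintype.card_fin] at hle
  have := i.pos
  simp at hle
  omega

theorem colorable_of_chromaticNumber_eq (hchi : H.chromaticNumber = (r : ℕ∞)) :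
    H.Colorable r :=
  chromaticNumber_le_iff_colorable.1 hchi.le

theorem exists_classSizes_eq_minClassSize (hr : 0 < r) (hH : H.Colorable r) :
    ∃ (c : H.Coloring (Fin r)) (i : Fin r), classSizes c i = minClassSize H r := by
  obtain ⟨c₀⟩ := hH
  obtain ⟨c, i, h⟩ : minClassSize H r ∈
      {s : ℕ | ∃ (c : H.Coloring (Fin r)) (i : Fin r), s = {v | c v = i}.ncard} :=
    Nat.sInf_mem ⟨_, c₀, ⟨0, hr⟩, rfl⟩
  exact ⟨c, i, congrArg Nat.cast h.symm⟩

/-- The sum of the class size vectors of all colourings is constant. -/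
theorem exists_sum_classSizes_eq [Fintype α] [Fintype (H.Coloring (Fin r))]
    (hr : 2 ≤ r) (hchi : H.chromaticNumber = (r : ℕ∞)) :
    ∃ q : ℤ, 0 < q ∧ ∀ i, ∑ c : H.Coloring (Fin r), classSizes c i = q := by
  classical
  obtain ⟨c₀⟩ := colorable_of_chromaticNumber_eq hchi
  let o : Fin r := ⟨0, by omega⟩
  refine ⟨∑ c : H.Coloring (Fin r), classSizes c o,
    Finset.sum_pos (fun c _ => classSizes_pos hchi c o) ⟨c₀, Finset.mem_univ _⟩, fun i => ?_⟩
  rw [← (Coloring.permute (Equiv.swap i o)).sum_comp]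
  refine Finset.sum_congr rfl fun c _ => ?_
  have h := classSizes_permute (Equiv.swap i o) c o
  rwa [Equiv.swap_apply_right] at h

/-- The colourings with smallest class `l` have class size vectors whose sum is constant
off `l`. -/
theorem exists_sum_filter_classSizes_eq [Fintype α] [Fintype (H.Coloring (Fin r))]
    (hchi : H.chromaticNumber = (r : ℕ∞)) (l : Fin r) :
    ∃ (a m : ℤ) (n : H.Coloring (Fin r) → ℤ), 0 < m ∧ (∀ c, 0 ≤ n c) ∧
      ((r : ℤ) - 1) * a = m * (Fintype.card α - minClassSize H r) ∧
      (∑ c, n c * classSizes c l = m * minClassSize H r) ∧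
      ∀ i, i ≠ l → ∑ c, n c * classSizes c i = a := by
  classical
  obtain ⟨c₁, i₁, h₁⟩ :=
    exists_classSizes_eq_minClassSize l.pos (colorable_of_chromaticNumber_eq hchi)
  let n : H.Coloring (Fin r) → ℤ := fun c => if classSizes c l = minClassSize H r then 1 else 0
  have hn0 (c) : 0 ≤ n c := by simp only [n]; split_ifs <;> simp
  have hnl : ∑ c, n c * classSizes c l = (∑ c, n c) * minClassSize H r := by
    rw [Finset.sum_mul]
    refine Finset.sum_congr rfl fun c _ => ?_
    simp only [n]
    split_ifs with hc <;> simp [hc]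
  have hsymm (i j : Fin r) (hi : i ≠ l) (hj : j ≠ l) :
      ∑ c, n c * classSizes c i = ∑ c, n c * classSizes c j := by
    rw [← (Coloring.permute (Equiv.swap i j)).sum_comp]
    refine Finset.sum_congr rfl fun c _ => ?_
    have hl : classSizes (Coloring.permute (Equiv.swap i j) c) l = classSizes c l := by
      have h := classSizes_permute (Equiv.swap i j) c l
      rwa [Equiv.swap_apply_of_ne_of_ne hi.symm hj.symm] at h
    have hij : classSizes (Coloring.permute (Equiv.swap i j) c) i = classSizes c j := by
      have h := classSizes_permute (Equiv.swap i j) c j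
      rwa [Equiv.swap_apply_right] at h
    simp only [n, hl, hij]
  have hm : 0 < ∑ c, n c := by
    refine Finset.sum_pos' (fun c _ => hn0 c)
      ⟨Coloring.permute (Equiv.swap i₁ l) c₁, Finset.mem_univ _, ?_⟩
    have hl : classSizes (Coloring.permute (Equiv.swap i₁ l) c₁) l = minClassSize H r := by
      have h := classSizes_permute (Equiv.swap i₁ l) c₁ i₁
      rwa [Equiv.swap_apply_left, h₁] at h
    simp [n, hl]
  obtain ⟨a, ha⟩ : ∃ a, ∀ i, i ≠ l → ∑ c, n c * classSizes c i = a := by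
    by_cases h : ∃ j, j ≠ l
    · obtain ⟨j, hj⟩ := h
      exact ⟨_, fun i hi => hsymm i j hi hj⟩
    · push Not at h
      exact ⟨0, fun i hi => (hi (h i)).elim⟩
  refine ⟨a, ∑ c, n c, n, hm, hn0, ?_, hnl, ha⟩
  have htot : ∑ i, ∑ c, n c * classSizes c i = (∑ c, n c) * Fintype.card α := by
    rw [Finset.sum_comm, Finset.sum_mul]
    exact Finset.sum_congr rfl fun c _ => by rw [← Finset.mul_sum, sum_classSizes]
  rw [← Finset.add_sum_erase _ _ (Finset.mem_univ l), hnl,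
    Finset.sum_congr rfl fun i hi => ha i (Finset.ne_of_mem_erase hi)] at htot
  simp only [Finset.sum_const, Finset.card_erase_of_mem (Finset.mem_univ l), Finset.card_univ,
    Fintype.card_fin, nsmul_eq_mul, Nat.cast_sub (show 1 ≤ r from l.pos)] at htot
  push_cast at htot
  linarith

/-- A complete multipartite graph whose vector of part sizes is close to a nonnegative
combination of a vector that is constant off `l` and a constant vector has a perfect tiling. -/
theorem exists_hasPerfectTiling_of_sum_abs_le [Fintype α] (hr : 2 ≤ r)
    (hchi : H.chromaticNumber = (r : ℕ∞)) (hhcf : HcfOne H r) (l : Fin r) :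
    ∃ a m q K : ℝ, 0 < m ∧ 0 < q ∧ 0 ≤ K ∧
      ((r : ℝ) - 1) * a = m * (Fintype.card α - minClassSize H r) ∧
      ∀ (u : Fin r → ℕ) (A B : ℤ), Fintype.card α ∣ ∑ i, u i → 0 ≤ A →
        K * ∑ i, |u i - A * (if i = l then m * minClassSize H r else a) - B * q| ≤ B →
        HasPerfectTiling H (completeMultipartiteGraph fun i => Fin (u i)) := by
  classical
  have : Fintype (H.Coloring (Fin r)) := Fintype.ofFinite _
  obtain ⟨K, hK0, hK⟩ :=
    exists_bounded_combination (by omega) hhcf (colorable_of_chromaticNumber_eq hchi)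
  obtain ⟨q, hq0, hq⟩ := exists_sum_classSizes_eq hr hchi
  obtain ⟨a, m, n₁, hm0, hn₁, ham, hbl, hal⟩ := exists_sum_filter_classSizes_eq hchi l
  refine ⟨a, m, q, K, by exact_mod_cast hm0, by exact_mod_cast hq0, by exact_mod_cast hK0,
    by exact_mod_cast ham, fun u A B hdvd hA0 hKB => ?_⟩
  let w : Fin r → ℤ := fun i => u i - ∑ c, (A * n₁ c + B) * classSizes c i
  have hw (i : Fin r) : w i = u i - A * (if i = l then m * minClassSize H r else a) - B * q := by
    have hi : ∑ c, n₁ c * classSizes c i = if i = l then m * (minClassSize H r : ℤ) else a := by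
      split_ifs with h
      · rw [h, hbl]
      · exact hal i h
    simp only [w, ← hi, ← hq i, Finset.mul_sum, add_mul, Finset.sum_add_distrib, mul_assoc]
    ring
  have hwdvd : (Fintype.card α : ℤ) ∣ ∑ i, w i := by
    simp only [w, Finset.sum_sub_distrib]
    refine dvd_sub (by exact_mod_cast hdvd) ?_
    rw [Finset.sum_comm]
    refine Finset.dvd_sum fun c _ => ?_
    rw [← Finset.mul_sum, sum_classSizes]
    exact dvd_mul_left _ _
  obtain ⟨n₂, hn₂, hn₂K⟩ := hK w hwdvd
  have hKB' : K * ∑ i, |w i| ≤ B := by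
    simp only [hw]
    exact_mod_cast hKB
  have hnonneg (c : H.Coloring (Fin r)) : 0 ≤ A * n₁ c + B + n₂ c := by
    have h1 := (abs_le.1 ((hn₂K c).trans hKB')).1
    have h2 := mul_nonneg hA0 (hn₁ c)
    linarith
  refine hasPerfectTiling_of_sum_classSizes u (fun c => (A * n₁ c + B + n₂ c).toNat) fun i => ?_
  have hwi := congrFun hn₂ i
  simp only [Finset.sum_apply, Pi.smul_apply, smul_eq_mul, w] at hwi
  simp only [Int.toNat_of_nonneg (hnonneg _), add_mul _ (n₂ _), Finset.sum_add_distrib, hwi]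
  ring

theorem exists_int_approx {a b q x y : ℝ} (hb : 0 ≤ b) (hab : b < a) (hq : 0 < q) (hyx : y ≤ x) :
    ∃ A B : ℤ, 0 ≤ A ∧ (a * y - b * x) / (q * (a - b)) - 1 ≤ B ∧
      |x - A * a - B * q| ≤ a + q ∧ |y - A * b - B * q| ≤ b + q := by
  have hd : 0 < a - b := sub_pos.2 hab
  set s := (x - y) / (a - b) with hs
  set t := (a * y - b * x) / (q * (a - b)) with ht
  have hx : x = s * a + t * q := by rw [hs, ht]; field_simp; ring
  have hy : y = s * b + t * q := by rw [hs, ht]; field_simp; ring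
  have hs1 := Int.floor_le s
  have hs2 := Int.lt_floor_add_one s
  have ht1 := Int.floor_le t
  have ht2 := Int.lt_floor_add_one t
  refine ⟨⌊s⌋, ⌊t⌋, Int.floor_nonneg.2 (div_nonneg (by linarith) hd.le), by linarith, ?_, ?_⟩
  · rw [hx, abs_le]
    constructor <;> nlinarith
  · rw [hy, abs_le]
    constructor <;> nlinarith

end SimpleGraph

/-- Lemma 4.9: sufficiently large, `h`-divisible, suitably unbalanced
complete `r`-partite graphs contain a perfect `H`-tiling when `hcf(H) = 1`.
The classes are `U i = Fin (u i)` for `i : Fin r`; `U_r` is the class of index `r - 1`. -/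
theorem generalised_KuhnOsthus_lemma
    {α : Type*} [Fintype α] (H : SimpleGraph α) (r : ℕ)
    (hr : 2 ≤ r) (hchi : H.chromaticNumber = (r : ℕ∞)) (hhcf : HcfOne H r)
    (σ ω h : ℝ) (hh : h = (Fintype.card α : ℝ))
    (hσ₁ : (minClassSize H r : ℝ) ≤ σ) (hσ₂ : σ < h / r)
    (hω : ω = (h - σ) / ((r : ℝ) - 1)) :
    ∃ lam beta : ℝ, 0 < beta ∧ beta < lam ∧
      lam < σ / ω ∧ lam < 1 - σ / ω ∧ lam < 1 / h ∧
      ∃ N : ℕ, ∀ u : Fin r → ℕ,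
        N ≤ ∑ i, u i →
        Fintype.card α ∣ ∑ i, u i →
        (∀ i : Fin r, (i : ℕ) + 1 < r →
          (1 - lam ^ ((1 : ℝ) / 10)) * (u ⟨r - 1, by omega⟩ : ℝ) ≤ σ * (u i) / ω ∧
            σ * (u i) / ω ≤ (1 - lam) * (u ⟨r - 1, by omega⟩ : ℝ)) →
        (∀ i j : Fin r, (i : ℕ) < (j : ℕ) → (j : ℕ) + 1 < r →
          |((u i : ℝ)) - (u j : ℝ)| ≤ beta * ((∑ i, u i : ℕ) : ℝ)) →
        HasPerfectTiling H (completeMultipartiteGraph fun i => Fin (u i)) := by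
  have hcol := colorable_of_chromaticNumber_eq hchi
  let l : Fin r := ⟨r - 1, by omega⟩
  let o : Fin r := ⟨0, by omega⟩
  have hol : o ≠ l := fun h => by simp [o, l] at h; omega
  have hlt (i : Fin r) (hi : i ≠ l) : (i : ℕ) + 1 < r := by
    have : (i : ℕ) ≠ r - 1 := fun h => hi (Fin.ext h)
    omega
  obtain ⟨a, m, q, K, hm0, hq0, hK0, ham, htiling⟩ :=
    exists_hasPerfectTiling_of_sum_abs_le hr hchi hhcf l
  have hs0 : 0 < minClassSize H r := by
    obtain ⟨c, i, hci⟩ := exists_classSizes_eq_minClassSize (by omega) hcol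
    have := classSizes_pos hchi c i
    omega
  set s := minClassSize H r
  set b : ℝ := m * s with hb
  set R : ℝ := (r : ℝ) - 1 with hR
  have hr2 : (2 : ℝ) ≤ r := by exact_mod_cast hr
  have hR1 : 1 ≤ R := by linarith
  have hs0' : (0 : ℝ) < s := by exact_mod_cast hs0
  have hσ0 : 0 < σ := hs0'.trans_le hσ₁
  have hhσ : (R + 1) * σ < h := by
    rw [lt_div_iff₀ (by linarith)] at hσ₂
    linarith
  have hh0 : 0 < h := lt_trans (by positivity) hhσ
  have hRω : R * ω = h - σ := by
    rw [hω]
    field_simp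
  have hσω : σ < ω := by nlinarith
  have hω0 : 0 < ω := hσ0.trans hσω
  rw [← hh] at ham
  set ρ := σ / ω with hρ
  have hρ0 : 0 < ρ := div_pos hσ0 hω0
  have hρ1 : ρ < 1 := (div_lt_one hω0).2 hσω
  have hρω : ρ * ω = σ := div_mul_cancel₀ _ hω0.ne'
  have hb0 : 0 < b := by rw [hb]; positivity
  have hba : b < a := by
    have h1 : 0 < R * (a - b) := by
      have : R * (a - b) = m * (h - (R + 1) * s) := by rw [mul_sub, ham, hb]; ring
      rw [this]
      exact mul_pos hm0 (by nlinarith)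
    nlinarith
  have ha0 : 0 < a := hb0.trans hba
  have hbρ : b ≤ a * ρ := by
    have h1 : b * (R * ω) ≤ a * ρ * (R * ω) := by
      have : a * ρ * (R * ω) = (R * a) * (ρ * ω) := by ring
      rw [this, ham, hρω, hRω, hb, mul_assoc, mul_assoc]
      exact mul_le_mul_of_nonneg_left (by nlinarith) hm0.le
    exact le_of_mul_le_mul_right h1 (by positivity)
  set μ := min (min ρ (1 - ρ)) (1 / h) / 2
  have hmin0 : 0 < min (min ρ (1 - ρ)) (1 / h) :=
    lt_min (lt_min hρ0 (sub_pos.2 hρ1)) (by positivity)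
  have hμ0 : 0 < μ := half_pos hmin0
  have hμmin : μ < min (min ρ (1 - ρ)) (1 / h) := half_lt_self hmin0
  obtain ⟨hμρ, hμh⟩ := lt_min_iff.1 hμmin
  obtain ⟨hμρ, hμρ'⟩ := lt_min_iff.1 hμρ
  have hlamμ : μ ^ 10 ≤ μ := pow_le_of_le_one hμ0.le (by linarith) (by norm_num)
  have hroot : (μ ^ 10) ^ ((1 : ℝ) / 10) = μ := by
    have := Real.pow_rpow_inv_natCast hμ0.le (n := 10) (by norm_num)
    simpa using this
  set lam := μ ^ 10
  have hlam0 : 0 < lam := by positivity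
  set κ : ℝ := a / (q * (a - b)) * (σ / h) with hκ
  have hκ0 : 0 < κ := mul_pos (div_pos ha0 (mul_pos hq0 (sub_pos.2 hba))) (div_pos hσ0 hh0)
  set beta := min (lam / 2) (κ * lam / (2 * (K * r + 1)))
  have hKr : 0 ≤ K * r := by positivity
  have hbeta0 : 0 < beta := lt_min (by positivity) (by positivity)
  have hKbeta : K * r * beta ≤ κ * lam / 2 := by
    have h1 : beta * (2 * (K * r + 1)) ≤ κ * lam :=
      (le_div_iff₀ (by positivity)).1 (min_le_right _ _)
    nlinarith
  refine ⟨lam, beta, hbeta0, (min_le_left _ _).trans_lt (half_lt_self hlam0), by linarith,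
    by linarith, by linarith, ⌈(2 * (1 + K * r * (a + b + q))) / (κ * lam)⌉₊,
    fun u hN hdvd hu hclose => ?_⟩
  rw [hroot] at hu
  have hN' := Nat.ceil_le.1 hN
  set S : ℝ := ((∑ i, u i : ℕ) : ℝ) with hS
  have hS0 : 0 ≤ S := Nat.cast_nonneg _
  rw [div_le_iff₀ (by positivity)] at hN'
  have hu₂ (i : Fin r) (hi : i ≠ l) : ρ * u i ≤ (1 - lam) * u l := by
    have := (hu i (hlt i hi)).2
    rwa [mul_div_right_comm] at this
  have hul0 : (0 : ℝ) ≤ u l := Nat.cast_nonneg _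
  have huo0 : (0 : ℝ) ≤ u o := Nat.cast_nonneg _
  have hlo : (u l : ℝ) ≤ u o := by
    have h1 := (hu o (hlt o hol)).1
    rw [mul_div_right_comm] at h1
    change (1 - μ) * (u l : ℝ) ≤ ρ * u o at h1
    have h2 : ρ * u o ≤ (1 - μ) * u o := mul_le_mul_of_nonneg_right (by linarith) huo0
    exact le_of_mul_le_mul_left (h1.trans h2) (by linarith)
  have hSl : σ / h * S ≤ u l := by
    have h1 : ρ * S ≤ (ρ + R) * u l := by
      rw [hS, Nat.cast_sum, ← Finset.add_sum_erase _ _ (Finset.mem_univ l), mul_add,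
        Finset.mul_sum, add_mul]
      gcongr
      refine (Finset.sum_le_card_nsmul _ _ (u l : ℝ) fun i hi => ?_).trans ?_
      · exact (hu₂ i (Finset.ne_of_mem_erase hi)).trans (mul_le_of_le_one_left hul0 (by linarith))
      · rw [Finset.card_erase_of_mem (Finset.mem_univ l), Finset.card_univ, Fintype.card_fin,
          nsmul_eq_mul, Nat.cast_sub (by omega), Nat.cast_one]
    have h2 : ω * (ρ + R) = h := by linarith
    have h3 := mul_le_mul_of_nonneg_left h1 hω0.le
    rw [← mul_assoc, ← mul_assoc, h2, mul_comm ω, hρω] at h3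
    rw [div_mul_eq_mul_div, div_le_iff₀ hh0]
    linarith
  obtain ⟨A, B, hA0, hB, hwo, hwl⟩ := exists_int_approx hb0.le hba hq0 hlo
  have hB' : κ * lam * S - 1 ≤ B := by
    refine le_trans (sub_le_sub_right ?_ 1) hB
    rw [le_div_iff₀ (mul_pos hq0 (sub_pos.2 hba))]
    have h1 : κ * lam * S * (q * (a - b)) = a * lam * (σ / h * S) := by
      rw [hκ]
      have := (sub_pos.2 hba).ne'
      field_simp
    rw [h1]
    have h2 := mul_le_mul_of_nonneg_left hSl (mul_pos ha0 hlam0).le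
    have h3 := mul_le_mul_of_nonneg_right hbρ huo0
    have h4 := mul_le_mul_of_nonneg_left (hu₂ o hol) ha0.le
    linarith
  refine htiling u A B hdvd hA0 ?_
  have hwabs (i : Fin r) :
      |(u i : ℝ) - A * (if i = l then b else a) - B * q| ≤ beta * S + (a + b + q) := by
    split_ifs with hi
    · rw [hi]
      have := mul_nonneg hbeta0.le hS0
      linarith
    · have h1 : |(u i : ℝ) - u o| ≤ beta * S := by
        by_cases hio : i = o
        · rw [hio, sub_self, abs_zero]
          positivity
        · rw [abs_sub_comm]
          exact hclose o i (Nat.pos_of_ne_zero fun h => hio (Fin.ext h)) (hlt i hi)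
      have h2 : (u i : ℝ) - A * a - B * q = (u i - u o) + (u o - A * a - B * q) := by ring
      rw [h2]
      exact (abs_add_le _ _).trans (by linarith)
  have h1 := Finset.sum_le_card_nsmul Finset.univ _ _ fun i _ => hwabs i
  rw [Finset.card_univ, Fintype.card_fin, nsmul_eq_mul] at h1
  have h2 := mul_le_mul_of_nonneg_left h1 hK0
  have h3 := mul_le_mul_of_nonneg_right hKbeta hS0
  linarith
end
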